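/- Let u ∈ S_n, let x ∈ N satisfy x u⁻¹ ∈ G_0, set A = u⁻¹ [x u⁻¹]_+ u and x_u = [u [A]_-]_+, and let d be a diagonal matrix with all diagonal entries positive. Then d A⁻¹ d⁻¹ A admits a Gaussian decomposition, the element n_- = [d A⁻¹ d⁻¹ A]_- belongs to N_-(u), the product (d x d⁻¹) n_- admits a Gaussian decomposition, and [(d x d⁻¹) n_-]_+ = x ([d A⁻¹ d⁻¹ A]_+)⁻¹, which moreover belongs to x_u N(u). -/

import Mathlib

open scoped Classical

namespace BruhatTNN

abbrev Mat (n : ℕ) := Matrix (Fin n) (Fin n) ℝ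

/-- `x` is upper unitriangular. -/
def upperUni {n : ℕ} (x : Mat n) : Prop :=
  (∀ i, x i i = 1) ∧ ∀ i j : Fin n, j < i → x i j = 0

/-- `x` is lower unitriangular. -/
def lowerUni {n : ℕ} (x : Mat n) : Prop :=
  (∀ i, x i i = 1) ∧ ∀ i j : Fin n, i < j → x i j = 0

/-- `x` is invertible upper triangular (`x ∈ B`). -/
def upperTriInv {n : ℕ} (x : Mat n) : Prop :=
  IsUnit x.det ∧ ∀ i j : Fin n, j < i → x i j = 0

/-- `x` is invertible lower triangular (`x ∈ B_-`). -/
def lowerTriInv {n : ℕ} (x : Mat n) : Prop :=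
  IsUnit x.det ∧ ∀ i j : Fin n, i < j → x i j = 0

/-- `x` is invertible diagonal (`x ∈ H`). -/
def diagInv {n : ℕ} (x : Mat n) : Prop :=
  IsUnit x.det ∧ ∀ i j : Fin n, i ≠ j → x i j = 0

/-- `x` admits a Gaussian decomposition (`x ∈ G_0`). -/
def hasGauss {n : ℕ} (x : Mat n) : Prop :=
  ∃ a d b : Mat n, lowerUni a ∧ diagInv d ∧ upperUni b ∧ x = a * d * b

/-- The factor `[x]_-` of the Gaussian decomposition (junk value `1` if none exists). -/
noncomputable def gaussMinus {n : ℕ} (x : Mat n) : Mat n :=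
  if h : hasGauss x then h.choose else 1

/-- The factor `[x]_0` of the Gaussian decomposition (junk value `1` if none exists). -/
noncomputable def gaussDiag {n : ℕ} (x : Mat n) : Mat n :=
  if h : hasGauss x then h.choose_spec.choose else 1

/-- The factor `[x]_+` of the Gaussian decomposition (junk value `1` if none exists). -/
noncomputable def gaussPlus {n : ℕ} (x : Mat n) : Mat n :=
  if h : hasGauss x then h.choose_spec.choose_spec.choose else 1

/-- The permutation matrix of `w`, with entry `1` in position `(w j, j)`. -/
def permMat {n : ℕ} (w : Equiv.Perm (Fin n)) : Mat n :=
  Matrix.of fun i j => if i = w j then (1 : ℝ) else 0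

/-- The minor of `x` with row set `I` and column set `J` (taken in increasing order). -/
def minorOf {n : ℕ} (x : Mat n) (k : ℕ) (I J : Finset (Fin n))
    (hI : I.card = k) (hJ : J.card = k) : ℝ :=
  Matrix.det (Matrix.of fun a b : Fin k => x (I.orderEmbOfFin hI a) (J.orderEmbOfFin hJ b))

/-- `x` is totally nonnegative: all its minors are nonnegative. -/
def totNonneg {n : ℕ} (x : Mat n) : Prop :=
  ∀ (k : ℕ) (I J : Finset (Fin n)) (hI : I.card = k) (hJ : J.card = k),
    0 ≤ minorOf x k I J hI hJ

/-- The Bruhat order on the symmetric group. -/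
def bruhatLE {n : ℕ} (u v : Equiv.Perm (Fin n)) : Prop :=
  ∀ i j : Fin n,
    (Finset.univ.filter fun k : Fin n => k ≤ i ∧ j ≤ u k).card ≤
    (Finset.univ.filter fun k : Fin n => k ≤ i ∧ j ≤ v k).card

/-- The double coset `B_- w B_-`. -/
def doubleCosetBm {n : ℕ} (w : Equiv.Perm (Fin n)) : Set (Mat n) :=
  {x | ∃ b₁ b₂ : Mat n, lowerTriInv b₁ ∧ lowerTriInv b₂ ∧ x = b₁ * permMat w * b₂}

/-- `N^w = B_- w B_- ∩ N`. -/
def Ncell {n : ℕ} (w : Equiv.Perm (Fin n)) : Set (Mat n) :=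
  {x | upperUni x ∧ x ∈ doubleCosetBm w}

/-- `N_-(w) = w⁻¹ N w ∩ N_-`. -/
def Nminus {n : ℕ} (w : Equiv.Perm (Fin n)) : Set (Mat n) :=
  {x | lowerUni x ∧ ∃ y : Mat n, upperUni y ∧ x = permMat w⁻¹ * y * permMat w}

/-- `N(w) = w⁻¹ N w ∩ N`. -/
def Ngrp {n : ℕ} (w : Equiv.Perm (Fin n)) : Set (Mat n) :=
  {x | upperUni x ∧ ∃ y : Mat n, upperUni y ∧ x = permMat w⁻¹ * y * permMat w}

/-- The totally positive cell `Y°_w = Y ∩ B_- w B_-`. -/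
def Ycirc {n : ℕ} (w : Equiv.Perm (Fin n)) : Set (Mat n) :=
  {x | upperUni x ∧ totNonneg x ∧ x ∈ doubleCosetBm w}

/-- `Y_{≥ u} = ⋃_{v ≥ u} Y°_v`. -/
def Yge {n : ℕ} (u : Equiv.Perm (Fin n)) : Set (Mat n) :=
  {x | ∃ v, bruhatLE u v ∧ x ∈ Ycirc v}

/-- `A = u⁻¹ [x u⁻¹]_+ u`. -/
noncomputable def Amat {n : ℕ} (u : Equiv.Perm (Fin n)) (x : Mat n) : Mat n :=
  permMat u⁻¹ * gaussPlus (x * permMat u⁻¹) * permMat u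

/-- The projection `π_u(x) = [u [u⁻¹ [x u⁻¹]_+ u]_-]_+`. -/
noncomputable def piMap {n : ℕ} (u : Equiv.Perm (Fin n)) (x : Mat n) : Mat n :=
  gaussPlus (permMat u * gaussMinus (Amat u x))

/-- `str(M)`: the sum of the matrix entries immediately above the main diagonal. -/
def strAbove {n : ℕ} (M : Mat n) : ℝ :=
  ∑ p : Fin n × Fin n, if (p.1 : ℕ) + 1 = (p.2 : ℕ) then M p.1 p.2 else 0

/-- The number of inversions (the length) of a permutation. -/
def invNum {n : ℕ} (w : Equiv.Perm (Fin n)) : ℕ :=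
  (Finset.univ.filter fun p : Fin n × Fin n => p.1 < p.2 ∧ w p.2 < w p.1).card

/-- `A` is unitriangular for the order on indices pulled back along `f`. -/
def uniTri {n : ℕ} {α : Type*} [LinearOrder α] (f : Fin n → α) (A : Mat n) : Prop :=
  (∀ i, A i i = 1) ∧ A.BlockTriangular f

section Triangular

variable {n : ℕ} {α : Type*} [LinearOrder α] {f : Fin n → α} {A B : Mat n}

theorem blockTriangular_mul_diag (hf : Function.Injective f) (hA : A.BlockTriangular f)
    (hB : B.BlockTriangular f) (i : Fin n) : (A * B) i i = A i i * B i i := by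
  rw [Matrix.mul_apply]
  refine Finset.sum_eq_single i (fun k _ hk => ?_) (by simp)
  rcases lt_or_gt_of_ne (hf.ne hk) with h | h
  · rw [hA h, zero_mul]
  · rw [hB h, mul_zero]

theorem uniTri.mul (hf : Function.Injective f) (hA : uniTri f A) (hB : uniTri f B) :
    uniTri f (A * B) :=
  ⟨fun i => by rw [blockTriangular_mul_diag hf hA.2 hB.2, hA.1, hB.1, one_mul], hA.2.mul hB.2⟩

theorem uniTri.inv (hf : Function.Injective f) (hA : uniTri f A) (hu : IsUnit A.det) :
    uniTri f A⁻¹ := by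
  have := Matrix.invertibleOfIsUnitDet A hu
  have ht := Matrix.blockTriangular_inv_of_blockTriangular hA.2
  refine ⟨fun i => ?_, ht⟩
  have h := blockTriangular_mul_diag hf hA.2 ht i
  rw [Matrix.mul_nonsing_inv A hu, hA.1, one_mul, Matrix.one_apply_eq] at h
  exact h.symm

theorem upperUni_iff_uniTri : upperUni A ↔ uniTri id A :=
  Iff.rfl.and ⟨fun h i j hij => h i j hij, fun h _ _ hij => h hij⟩

theorem lowerUni_iff_uniTri : lowerUni A ↔ uniTri OrderDual.toDual A :=
  Iff.rfl.and ⟨fun h i j hij => h i j hij, fun h _ _ hij => h hij⟩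

theorem upperUni.det_eq_one (hA : upperUni A) : A.det = 1 := by
  rw [Matrix.det_of_isUpperTriangular (upperUni_iff_uniTri.1 hA).2]
  simp [hA.1]

theorem lowerUni.det_eq_one (hA : lowerUni A) : A.det = 1 := by
  rw [Matrix.det_of_isLowerTriangular A (lowerUni_iff_uniTri.1 hA).2]
  simp [hA.1]

theorem upperUni.isUnit_det (hA : upperUni A) : IsUnit A.det := by simp [hA.det_eq_one]

theorem upperUni.mul (hA : upperUni A) (hB : upperUni B) : upperUni (A * B) :=
  upperUni_iff_uniTri.2 ((upperUni_iff_uniTri.1 hA).mul Function.injective_id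
    (upperUni_iff_uniTri.1 hB))

theorem upperUni.inv (hA : upperUni A) : upperUni A⁻¹ :=
  upperUni_iff_uniTri.2 ((upperUni_iff_uniTri.1 hA).inv Function.injective_id hA.isUnit_det)

theorem lowerTriInv.mul (hA : lowerTriInv A) (hB : lowerTriInv B) : lowerTriInv (A * B) := by
  have h : (A * B).BlockTriangular OrderDual.toDual :=
    Matrix.BlockTriangular.mul (fun i j hij => hA.2 i j hij) (fun i j hij => hB.2 i j hij)
  exact ⟨by rw [Matrix.det_mul]; exact hA.1.mul hB.1, fun _ _ hij => h hij⟩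

theorem lowerTriInv.inv (hA : lowerTriInv A) : lowerTriInv A⁻¹ := by
  have := Matrix.invertibleOfIsUnitDet A hA.1
  have h : A.BlockTriangular OrderDual.toDual := fun i j hij => hA.2 i j hij
  exact ⟨Matrix.isUnit_nonsing_inv_det A hA.1,
    fun _ _ hij => Matrix.blockTriangular_inv_of_blockTriangular h hij⟩

theorem lowerUni.lowerTriInv (hA : lowerUni A) : lowerTriInv A :=
  ⟨by simp [hA.det_eq_one], hA.2⟩

theorem diagInv.lowerTriInv (hA : diagInv A) : lowerTriInv A :=
  ⟨hA.1, fun i j hij => hA.2 i j hij.ne⟩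

theorem lowerTriInv.diag_ne_zero (hA : lowerTriInv A) (i : Fin n) : A i i ≠ 0 := by
  have h := hA.1.ne_zero
  rw [Matrix.det_of_isLowerTriangular A (fun i j hij => hA.2 i j hij)] at h
  exact Finset.prod_ne_zero_iff.1 h i (Finset.mem_univ i)

/-- Conjugation by an invertible diagonal matrix preserves unitriangularity. -/
theorem uniTri.diag_conj (hA : uniTri f A) {c : Fin n → ℝ} (hc : ∀ i, c i ≠ 0) :
    uniTri f (Matrix.diagonal c * A * (Matrix.diagonal c)⁻¹) := by
  have hinv : (Matrix.diagonal c)⁻¹ = Matrix.diagonal fun i => (c i)⁻¹ := by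
    refine Matrix.inv_eq_right_inv ?_
    rw [Matrix.diagonal_mul_diagonal]
    simp [hc]
  rw [hinv]
  refine ⟨fun i => ?_, fun i j hij => ?_⟩
  · simp [Matrix.diagonal_mul, Matrix.mul_diagonal, hA.1, hc]
  · simp [Matrix.diagonal_mul, Matrix.mul_diagonal, hA.2 hij]

end Triangular

section Gauss

variable {n : ℕ}

theorem eq_one_of_lowerTri_upperUni {M : Mat n} (hl : lowerTriInv M) (hu : upperUni M) :
    M = 1 := by
  ext i j
  rcases lt_trichotomy i j with h | h | h
  · rw [hl.2 i j h, Matrix.one_apply_ne h.ne]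
  · rw [h, hu.1, Matrix.one_apply_eq]
  · rw [hu.2 i j h, Matrix.one_apply_ne h.ne']

theorem upperUni_unique {l l' b b' : Mat n} (hl : lowerTriInv l) (hl' : lowerTriInv l')
    (hb : upperUni b) (hb' : upperUni b') (h : l * b = l' * b') : b = b' := by
  have h1 : l'⁻¹ * l = b' * b⁻¹ := by
    calc l'⁻¹ * l = l'⁻¹ * (l * b) * b⁻¹ := by
          rw [Matrix.mul_assoc, Matrix.mul_nonsing_inv_cancel_right _ _ hb.isUnit_det]
      _ = b' * b⁻¹ := by
          rw [h, Matrix.nonsing_inv_mul_cancel_left _ _ hl'.1]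
  have h2 : b' * b⁻¹ = 1 :=
    eq_one_of_lowerTri_upperUni (h1 ▸ hl'.inv.mul hl) (hb'.mul hb.inv)
  calc b = b' * b⁻¹ * b := by rw [h2, Matrix.one_mul]
    _ = b' := Matrix.nonsing_inv_mul_cancel_right _ _ hb.isUnit_det

theorem hasGauss.spec {g : Mat n} (h : hasGauss g) : ∃ e : Mat n, lowerUni (gaussMinus g) ∧
    diagInv e ∧ upperUni (gaussPlus g) ∧ g = gaussMinus g * e * gaussPlus g := by
  refine ⟨h.choose_spec.choose, ?_⟩
  rw [gaussMinus, gaussPlus, dif_pos h, dif_pos h]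
  exact h.choose_spec.choose_spec.choose_spec

theorem hasGauss_of_lowerTri_mul {l b : Mat n} (hl : lowerTriInv l) (hb : upperUni b) :
    hasGauss (l * b) := by
  have hne := hl.diag_ne_zero
  refine ⟨l * Matrix.diagonal fun i => (l i i)⁻¹, Matrix.diagonal fun i => l i i, b,
    ⟨fun i => ?_, fun i j hij => ?_⟩, ⟨?_, fun i j hij => Matrix.diagonal_apply_ne _ hij⟩, hb, ?_⟩
  · rw [Matrix.mul_diagonal, mul_inv_cancel₀ (hne i)]
  · rw [Matrix.mul_diagonal, hl.2 i j hij, zero_mul]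
  · rw [Matrix.det_diagonal, isUnit_iff_ne_zero]
    exact Finset.prod_ne_zero_iff.2 fun i _ => hne i
  · rw [Matrix.mul_assoc l, Matrix.diagonal_mul_diagonal]
    simp [hne]

theorem gaussPlus_lowerTri_mul {l b : Mat n} (hl : lowerTriInv l) (hb : upperUni b) :
    gaussPlus (l * b) = b := by
  obtain ⟨e, h1, h2, h3, h4⟩ := (hasGauss_of_lowerTri_mul hl hb).spec
  exact (upperUni_unique hl (h1.lowerTriInv.mul h2.lowerTriInv) hb h3 h4).symm

theorem gaussMinus_lowerUni_mul {a b : Mat n} (ha : lowerUni a) (hb : upperUni b) :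
    gaussMinus (a * b) = a := by
  obtain ⟨e, h1, h2, h3, h4⟩ := (hasGauss_of_lowerTri_mul ha.lowerTriInv hb).spec
  rw [gaussPlus_lowerTri_mul ha.lowerTriInv hb] at h4
  have h5 : a = gaussMinus (a * b) * e := by
    have h6 := congrArg (· * b⁻¹) h4
    simpa only [Matrix.mul_nonsing_inv_cancel_right _ _ hb.isUnit_det] using h6
  have he : e = 1 := by
    ext i j
    rcases eq_or_ne i j with rfl | hij
    · have h7 := blockTriangular_mul_diag OrderDual.toDual.injective (lowerUni_iff_uniTri.1 h1).2
        (fun i j hij => h2.2 i j (ne_of_lt hij)) i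
      rw [← h5, ha.1, h1.1, one_mul] at h7
      rw [← h7, Matrix.one_apply_eq]
    · rw [h2.2 i j hij, Matrix.one_apply_ne hij]
  rw [he, Matrix.mul_one] at h5
  exact h5.symm

end Gauss

/-- A matrix that is unitriangular for an arbitrary order on the indices is the product of a lower
and an upper unitriangular matrix, both unitriangular for that order. -/
theorem uniTri.exists_lowerUni_mul_upperUni {α : Type*} [LinearOrder α] {n : ℕ} {f : Fin n → α}
    (hf : Function.Injective f) {A : Mat n} (hA : uniTri f A) :
    ∃ L P : Mat n, lowerUni L ∧ upperUni P ∧ uniTri f L ∧ uniTri f P ∧ A = L * P := by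
  induction n with
  | zero =>
    exact ⟨A, A, ⟨fun i => i.elim0, fun i => i.elim0⟩, ⟨fun i => i.elim0, fun i => i.elim0⟩,
      hA, hA, by ext i; exact i.elim0⟩
  | succ n ih =>
    have hS : uniTri (f ∘ Fin.succ)
        (Matrix.of fun i j : Fin n => A i.succ j.succ - A i.succ 0 * A 0 j.succ) := by
      have key : ∀ i j : Fin n, f j.succ ≤ f i.succ → A i.succ 0 * A 0 j.succ = 0 := by
        intro i j hij
        rcases lt_or_ge (f 0) (f i.succ) with h | h
        · rw [hA.2 h, zero_mul]
        · have h0 : f j.succ < f 0 :=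
            lt_of_le_of_ne (hij.trans h) (hf.ne (Fin.succ_ne_zero j))
          rw [hA.2 h0, mul_zero]
      refine ⟨fun i => ?_, fun i j hij => ?_⟩
      · simp [key i i le_rfl, hA.1]
      · have hij' : f j.succ < f i.succ := hij
        simp [key i j hij'.le, hA.2 hij']
    obtain ⟨L, P, hL, hP, hLf, hPf, hLP⟩ := ih (hf.comp (Fin.succ_injective n)) hS
    refine ⟨Matrix.of fun i j => Fin.cases (Fin.cases 1 (fun _ => 0) j)
        (fun i' => Fin.cases (A i'.succ 0) (fun j' => L i' j') j) i,
      Matrix.of fun i j => Fin.cases (Fin.cases 1 (fun j' => A 0 j'.succ) j)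
        (fun i' => Fin.cases 0 (fun j' => P i' j') j) i, ⟨?_, ?_⟩, ⟨?_, ?_⟩, ⟨?_, ?_⟩, ⟨?_, ?_⟩, ?_⟩
    · intro i
      cases i using Fin.cases with
      | zero => simp
      | succ i => simp [hL.1]
    · intro i j hij
      cases i using Fin.cases with
      | zero =>
        cases j using Fin.cases with
        | zero => simp at hij
        | succ j => simp
      | succ i =>
        cases j using Fin.cases with
        | zero => simp at hij
        | succ j => simpa using hL.2 i j (by simpa using hij)
    · intro i
      cases i using Fin.cases with
      | zero => simp
      | succ i => simp [hP.1]
    · intro i j hij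
      cases j using Fin.cases with
      | zero =>
        cases i using Fin.cases with
        | zero => simp at hij
        | succ j => simp
      | succ j =>
        cases i using Fin.cases with
        | zero => simp at hij
        | succ i => simpa using hP.2 i j (by simpa using hij)
    · intro i
      cases i using Fin.cases with
      | zero => simp
      | succ i => simp [hL.1]
    · intro i j hij
      cases i using Fin.cases with
      | zero =>
        cases j using Fin.cases with
        | zero => simp at hij
        | succ j => simp
      | succ i =>
        cases j using Fin.cases with
        | zero => simpa using hA.2 hij
        | succ j => simpa using hLf.2 (i := i) (j := j) hij
    · intro i
      cases i using Fin.cases with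
      | zero => simp
      | succ i => simp [hP.1]
    · intro i j hij
      cases i using Fin.cases with
      | zero =>
        cases j using Fin.cases with
        | zero => simp at hij
        | succ j => simpa using hA.2 hij
      | succ i =>
        cases j using Fin.cases with
        | zero => simp
        | succ j => simpa using hPf.2 (i := i) (j := j) hij
    · ext i j
      have hentry : ∀ i' j' : Fin n,
          A i'.succ j'.succ - A i'.succ 0 * A 0 j'.succ = ∑ k, L i' k * P k j' :=
        fun i' j' => by rw [← Matrix.mul_apply, ← hLP, Matrix.of_apply]
      rw [Matrix.mul_apply, Fin.sum_univ_succ]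
      cases i using Fin.cases with
      | zero =>
        cases j using Fin.cases with
        | zero => simp [hA.1]
        | succ j => simp
      | succ i =>
        cases j using Fin.cases with
        | zero => simp
        | succ j => simp [← hentry]

section Permutation

variable {n : ℕ} (u : Equiv.Perm (Fin n))

theorem permMat_inv_mul_mul_apply (y : Mat n) (i j : Fin n) :
    (permMat u⁻¹ * y * permMat u) i j = y (u i) (u j) := by
  simp [Matrix.mul_apply, permMat, Equiv.eq_symm_apply]

theorem permMat_mul_permMat_inv : permMat u * permMat u⁻¹ = (1 : Mat n) := by
  have h := permMat_inv_mul_mul_apply u⁻¹ (1 : Mat n)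
  rw [inv_inv, Matrix.mul_one] at h
  ext i j
  rw [h]
  simp [Matrix.one_apply]

theorem permMat_inv_mul_permMat : permMat u⁻¹ * permMat u = (1 : Mat n) := by
  have h := permMat_mul_permMat_inv u⁻¹
  rwa [inv_inv] at h

theorem uniTri_perm_iff {A : Mat n} :
    uniTri u A ↔ ∃ y : Mat n, upperUni y ∧ A = permMat u⁻¹ * y * permMat u := by
  constructor
  · intro h
    refine ⟨A.submatrix u.symm u.symm, ⟨fun i => h.1 _, fun i j hij => h.2 (by simpa using hij)⟩, ?_⟩
    ext i j
    rw [permMat_inv_mul_mul_apply]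
    simp
  · rintro ⟨y, hy, rfl⟩
    refine ⟨fun i => ?_, fun i j hij => ?_⟩
    · rw [permMat_inv_mul_mul_apply, hy.1]
    · rw [permMat_inv_mul_mul_apply, hy.2 _ _ hij]

theorem lowerTriInv_perm_conj_diag {c : Fin n → ℝ} (hc : ∀ i, c i ≠ 0) :
    lowerTriInv (permMat u * Matrix.diagonal c * permMat u⁻¹) := by
  have h : permMat u * Matrix.diagonal c * permMat u⁻¹ =
      Matrix.diagonal fun i => c (u⁻¹ i) := by
    ext i j
    have h := permMat_inv_mul_mul_apply u⁻¹ (Matrix.diagonal c) i j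
    rw [inv_inv] at h
    rw [h]
    simp [Matrix.diagonal_apply]
  rw [h]
  refine diagInv.lowerTriInv ⟨?_, fun i j hij => Matrix.diagonal_apply_ne _ hij⟩
  rw [Matrix.det_diagonal, isUnit_iff_ne_zero]
  exact Finset.prod_ne_zero_iff.2 fun i _ => hc _

end Permutation

theorem statement14 (n : ℕ) (hn : 1 ≤ n) (u : Equiv.Perm (Fin n)) (x : Mat n)
    (hx : upperUni x) (hg : hasGauss (x * permMat u⁻¹))
    (d : Mat n) (hdiag : ∀ i j : Fin n, i ≠ j → d i j = 0) (hpos : ∀ i, 0 < d i i) :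
    hasGauss (d * (Amat u x)⁻¹ * d⁻¹ * Amat u x) ∧
    gaussMinus (d * (Amat u x)⁻¹ * d⁻¹ * Amat u x) ∈ Nminus u ∧
    hasGauss ((d * x * d⁻¹) * gaussMinus (d * (Amat u x)⁻¹ * d⁻¹ * Amat u x)) ∧
    gaussPlus ((d * x * d⁻¹) * gaussMinus (d * (Amat u x)⁻¹ * d⁻¹ * Amat u x)) =
      x * (gaussPlus (d * (Amat u x)⁻¹ * d⁻¹ * Amat u x))⁻¹ ∧
    (∃ m ∈ Ngrp u,
      gaussPlus ((d * x * d⁻¹) * gaussMinus (d * (Amat u x)⁻¹ * d⁻¹ * Amat u x)) =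
        piMap u x * m) := by
  have hinj : Function.Injective u := u.injective
  obtain ⟨e, hlow, he, hy, hxy⟩ := hg.spec
  have hA : uniTri u (Amat u x) := (uniTri_perm_iff u).2 ⟨_, hy, rfl⟩
  have hAdet : IsUnit (Amat u x).det := by
    obtain ⟨L, P, hL, hP, -, -, hLP⟩ := hA.exists_lowerUni_mul_upperUni hinj
    simp [hLP, hL.det_eq_one, hP.det_eq_one]
  -- `x` factors through `A`
  obtain ⟨b, hb, hxb⟩ : ∃ b : Mat n, lowerTriInv b ∧ x = b * permMat u * Amat u x := by
    refine ⟨_, hlow.lowerTriInv.mul he.lowerTriInv, ?_⟩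
    calc x = x * (permMat u⁻¹ * permMat u) := by
          rw [permMat_inv_mul_permMat, Matrix.mul_one]
      _ = gaussMinus (x * permMat u⁻¹) * e * gaussPlus (x * permMat u⁻¹) * permMat u := by
          rw [← Matrix.mul_assoc]
          exact congrArg (· * permMat u) hxy
      _ = gaussMinus (x * permMat u⁻¹) * e * (permMat u * permMat u⁻¹) *
            gaussPlus (x * permMat u⁻¹) * permMat u := by
          rw [permMat_mul_permMat_inv, Matrix.mul_one]
      _ = _ := by simp only [Amat, Matrix.mul_assoc]
  have hd : d = Matrix.diagonal fun i => d i i := by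
    ext i j
    rcases eq_or_ne i j with rfl | hij
    · simp
    · rw [hdiag i j hij, Matrix.diagonal_apply_ne _ hij]
  have hdne : ∀ i, d i i ≠ 0 := fun i => (hpos i).ne'
  have hdlow : lowerTriInv d := by
    refine diagInv.lowerTriInv ⟨?_, hdiag⟩
    rw [hd, Matrix.det_diagonal, isUnit_iff_ne_zero]
    exact Finset.prod_ne_zero_iff.2 fun i _ => hdne i
  have hdinv : d⁻¹ = Matrix.diagonal fun i => (d i i)⁻¹ := by
    refine Matrix.inv_eq_right_inv ?_
    nth_rewrite 1 [hd]
    rw [Matrix.diagonal_mul_diagonal]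
    simp [hdne]
  have hW : uniTri u (d * (Amat u x)⁻¹ * d⁻¹ * Amat u x) := by
    have h := (hA.inv hinj hAdet).diag_conj hdne
    rw [← hd] at h
    exact h.mul hinj hA
  obtain ⟨L, P, hL, hP, hLu, hPu, hLP⟩ := hW.exists_lowerUni_mul_upperUni hinj
  obtain ⟨Am, Ap, hAm, hAp, -, hApu, hAA⟩ := hA.exists_lowerUni_mul_upperUni hinj
  have hminus : gaussMinus (d * (Amat u x)⁻¹ * d⁻¹ * Amat u x) = L := by
    rw [hLP, gaussMinus_lowerUni_mul hL hP]
  have hplus : gaussPlus (d * (Amat u x)⁻¹ * d⁻¹ * Amat u x) = P := by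
    rw [hLP, gaussPlus_lowerTri_mul hL.lowerTriInv hP]
  have hxP : upperUni (x * P⁻¹) := hx.mul hP.inv
  have hl : lowerTriInv (d * b * (permMat u * d⁻¹ * permMat u⁻¹) * b⁻¹) := by
    rw [hdinv]
    exact ((hdlow.mul hb).mul
      (lowerTriInv_perm_conj_diag u fun i => inv_ne_zero (hdne i))).mul hb.inv
  have hprod : d * x * d⁻¹ * L =
      d * b * (permMat u * d⁻¹ * permMat u⁻¹) * b⁻¹ * (x * P⁻¹) := by
    have hL' : L = d * (Amat u x)⁻¹ * d⁻¹ * Amat u x * P⁻¹ := by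
      rw [hLP, Matrix.mul_nonsing_inv_cancel_right _ _ hP.isUnit_det]
    have h1 : d * x * d⁻¹ * L = d * b * permMat u * d⁻¹ * Amat u x * P⁻¹ := by
      rw [hL']
      generalize Amat u x = A at hxb hAdet ⊢
      rw [hxb]
      simp only [Matrix.mul_assoc]
      rw [Matrix.nonsing_inv_mul_cancel_left _ _ hdlow.1,
        Matrix.mul_nonsing_inv_cancel_left _ _ hAdet]
    rw [h1]
    conv_rhs => rw [hxb]
    simp only [Matrix.mul_assoc]
    rw [Matrix.nonsing_inv_mul_cancel_left _ _ hb.1, ← Matrix.mul_assoc (permMat u⁻¹),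
      permMat_inv_mul_permMat, Matrix.one_mul]
  have hpi : piMap u x = x * Ap⁻¹ := by
    have h : permMat u * Am = b⁻¹ * (x * Ap⁻¹) := by
      conv_rhs => rw [hxb, hAA]
      simp only [Matrix.mul_assoc]
      rw [Matrix.nonsing_inv_mul_cancel_left _ _ hb.1, Matrix.mul_nonsing_inv _ hAp.isUnit_det,
        Matrix.mul_one]
    rw [piMap, hAA, gaussMinus_lowerUni_mul hAm hAp, h,
      gaussPlus_lowerTri_mul hb.inv (hx.mul hAp.inv)]
  have hmain : gaussPlus (d * x * d⁻¹ * L) = x * P⁻¹ := by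
    rw [hprod, gaussPlus_lowerTri_mul hl hxP]
  rw [hminus, hplus, hmain]
  refine ⟨?_, ⟨hL, (uniTri_perm_iff u).1 hLu⟩, ?_, rfl, Ap * P⁻¹,
    ⟨hAp.mul hP.inv, (uniTri_perm_iff u).1 (hApu.mul hinj (hPu.inv hinj hP.isUnit_det))⟩, ?_⟩
  · rw [hLP]
    exact hasGauss_of_lowerTri_mul hL.lowerTriInv hP
  · rw [hprod]
    exact hasGauss_of_lowerTri_mul hl hxP
  · rw [hpi, ← Matrix.mul_assoc, Matrix.nonsing_inv_mul_cancel_right _ _ hAp.isUnit_det]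

end BruhatTNN
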